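/- Let n ≥ 2 be an integer and ξ a real number with ŵ_n(ξ) > 2n−2 (such ξ is necessarily not algebraic of degree at most n, so the best approximation sequence is defined). Then for all sufficiently large k, the 2(n−1) polynomials in V_{k−1} ∪ V_k are linearly independent over ℚ, and hence span a hyperplane in the (2n−1)-dimensional ℚ-vector space of polynomials of degree at most 2n−2. -/

import Mathlib

open Polynomial Filter

noncomputable section

/-- Height of an integer polynomial: maximum absolute value of its coefficients. -/
def polyHeight (P : Polynomial ℤ) : ℕ :=
  P.support.sup fun i => (P.coeff i).natAbs

/-- The set of exponents `w` admissible for the uniform exponent `ŵ_n(ξ)`. -/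
def uniformExpSet (n : ℕ) (ξ : ℝ) : Set ℝ :=
  {w | ∀ᶠ X : ℝ in atTop, ∃ P : Polynomial ℤ, P.natDegree ≤ n ∧
    (polyHeight P : ℝ) ≤ X ∧ 0 < |Polynomial.aeval ξ P| ∧
    |Polynomial.aeval ξ P| < X ^ (-w)}

/-- The uniform exponent `ŵ_n(ξ)`, as an extended real. -/
def wHat (n : ℕ) (ξ : ℝ) : EReal :=
  sSup ((fun w : ℝ => (w : EReal)) '' uniformExpSet n ξ)

/-- The set of exponents `w` admissible for the ordinary exponent `w_n(ξ)`. -/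
def ordExpSet (n : ℕ) (ξ : ℝ) : Set ℝ :=
  {w | {P : Polynomial ℤ | P.natDegree ≤ n ∧ 0 < |Polynomial.aeval ξ P| ∧
      |Polynomial.aeval ξ P| < (polyHeight P : ℝ) ^ (-w)}.Infinite}

/-- The ordinary exponent `w_n(ξ)`, as an extended real. -/
def wOrd (n : ℕ) (ξ : ℝ) : EReal :=
  sSup ((fun w : ℝ => (w : EReal)) '' ordExpSet n ξ)

/-- `P` (1-indexed: the relevant values are `P 1, P 2, …`) is the sequence of best
approximation polynomials associated to `(n, ξ)`. -/
structure IsBestApproxSeq (n : ℕ) (ξ : ℝ) (P : ℕ → Polynomial ℤ) : Prop where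
  ne_zero : ∀ k, 1 ≤ k → P k ≠ 0
  deg_le : ∀ k, 1 ≤ k → (P k).natDegree ≤ n
  height_lt : ∀ k, 1 ≤ k → polyHeight (P k) < polyHeight (P (k+1))
  eval_lt : ∀ k, 1 ≤ k → |Polynomial.aeval ξ (P (k+1))| < |Polynomial.aeval ξ (P k)|
  isMin : ∀ k, 1 ≤ k → ∀ Q : Polynomial ℤ, Q ≠ 0 → Q.natDegree ≤ n →
    polyHeight Q ≤ polyHeight (P k) →
    |Polynomial.aeval ξ (P k)| ≤ |Polynomial.aeval ξ Q|
  complete : ∀ Q : Polynomial ℤ, Q ≠ 0 → Q.natDegree ≤ n →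
    (∀ R : Polynomial ℤ, R ≠ 0 → R.natDegree ≤ n → polyHeight R ≤ polyHeight Q →
      |Polynomial.aeval ξ Q| ≤ |Polynomial.aeval ξ R|) →
    ∃ k, 1 ≤ k ∧ (Q = P k ∨ Q = -P k)

/-- The image of an integer polynomial in `ℚ[X]`. -/
def ratPoly (P : Polynomial ℤ) : Polynomial ℚ := P.map (Int.castRingHom ℚ)

/-- `k` is good for the sequence `P`: `P_{k-1}, P_k, P_{k+1}` are `ℚ`-linearly independent. -/
def Good (P : ℕ → Polynomial ℤ) (k : ℕ) : Prop :=
  LinearIndependent ℚ ![ratPoly (P (k-1)), ratPoly (P k), ratPoly (P (k+1))]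

/-- `τ_k = log H_k / log H_{k-1}`. -/
def tauk (P : ℕ → Polynomial ℤ) (k : ℕ) : ℝ :=
  Real.log (polyHeight (P k)) / Real.log (polyHeight (P (k-1)))

/-- `μ_k = -log |P_{k-1}(ξ)| / log H_k`. -/
def muk (ξ : ℝ) (P : ℕ → Polynomial ℤ) (k : ℕ) : ℝ :=
  - Real.log |Polynomial.aeval ξ (P (k-1))| / Real.log (polyHeight (P k))

/-- `v_k = -log |P_k(ξ)| / log H_k`. -/
def vk (ξ : ℝ) (P : ℕ → Polynomial ℤ) (k : ℕ) : ℝ :=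
  - Real.log |Polynomial.aeval ξ (P k)| / Real.log (polyHeight (P k))

/-- The set of integers `m ≥ k+1` such that `P_{k-1}, …, P_{m-1}` all lie in the
two-dimensional space spanned by `P_{k-1}` and `P_k`; its greatest element is `ℓ(k)`. -/
def ellSet (P : ℕ → Polynomial ℤ) (k : ℕ) : Set ℕ :=
  {m | k + 1 ≤ m ∧ ∀ j, k - 1 ≤ j → j ≤ m - 1 →
    ratPoly (P j) ∈ Submodule.span ℚ {ratPoly (P (k-1)), ratPoly (P k)}}

/-- The set `V_k = {P, T·P, …, T^{n-2}·P}` (as rational polynomials). -/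
def Vset (n : ℕ) (A : Polynomial ℤ) : Set (Polynomial ℚ) :=
  {q | ∃ i ≤ n - 2, q = Polynomial.X ^ i * ratPoly A}

/-- The trajectory `L_P(q) = max(log H(P) - q/(2n-2), log |P(ξ)| + q)`. -/
def LPtraj (n : ℕ) (ξ : ℝ) (Q : Polynomial ℤ) (q : ℝ) : ℝ :=
  max (Real.log (polyHeight Q) - q / (2*(n:ℝ)-2)) (Real.log |Polynomial.aeval ξ Q| + q)

/-- The `j`-th successive minimum function `L_j(q)`: the infimum over sets of `j`
linearly independent integer polynomials of degree at most `2n-2` of the maximum of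
`L_P(q)` over the set. -/
def Lj (n : ℕ) (ξ : ℝ) (j : ℕ) (q : ℝ) : ℝ :=
  sInf {y : ℝ | ∃ S : Finset (Polynomial ℤ), S.card = j ∧
    (∀ Q ∈ S, Q.natDegree ≤ 2*n-2) ∧
    LinearIndependent ℚ (fun Q : {x // x ∈ S} => ratPoly (Q : Polynomial ℤ)) ∧
    y = sSup ((fun Q => LPtraj n ξ Q q) '' (S : Set (Polynomial ℤ)))}

open Nat in
/-- If some combination `v ᵥ* A` of the rows of `A`, involving row `i` with coefficient `1`, has
all entries at most `δ` in absolute value, then `det A` is small. -/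
lemma abs_det_le_of_vecMul_le {N : ℕ} (A : Matrix (Fin N) (Fin N) ℝ) (v : Fin N → ℝ) (i : Fin N)
    (hv : v i = 1) {B δ : ℝ} (hB : ∀ i j, |A i j| ≤ B) (hδ : ∀ j, |(Matrix.vecMul v A) j| ≤ δ) :
    |A.det| ≤ N ! * B ^ (N - 1) * δ := by
  obtain _ | N := N
  · exact i.elim0
  have hdet : A.det = ∑ j, Matrix.vecMul v A j * A.adjugate j i := by
    have h : Matrix.vecMul (Matrix.vecMul v A) A.adjugate i = A.det := by
      rw [Matrix.vecMul_vecMul, Matrix.mul_adjugate, Matrix.vecMul_smul, Matrix.vecMul_one]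
      simp [hv]
    rw [← h]
    rfl
  have hadj : ∀ j, |A.adjugate j i| ≤ N ! * B ^ N := by
    intro j
    rw [Matrix.adjugate_fin_succ_eq_det_submatrix, abs_mul, abs_pow, abs_neg, abs_one, one_pow,
      one_mul]
    have := Matrix.det_le (A := A.submatrix i.succAbove j.succAbove) (abv := AbsoluteValue.abs)
      (x := B) fun _ _ => hB _ _
    simpa using this
  have hδ0 : 0 ≤ δ := (abs_nonneg _).trans (hδ i)
  calc |A.det| ≤ ∑ j, |Matrix.vecMul v A j * A.adjugate j i| := by
        rw [hdet]; exact Finset.abs_sum_le_sum_abs _ _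
    _ ≤ ∑ _j : Fin (N + 1), δ * (N ! * B ^ N) := by
        refine Finset.sum_le_sum fun j _ => ?_
        rw [abs_mul]
        exact mul_le_mul (hδ j) (hadj j) (abs_nonneg _) hδ0
    _ = (N + 1)! * B ^ (N + 1 - 1) * δ := by
        rw [Finset.sum_const, Finset.card_univ, Fintype.card_fin, Nat.factorial_succ,
          Nat.add_sub_cancel]
        push_cast [nsmul_eq_mul]
        ring

lemma sum_pow_mul_sylvester_column {g : ℝ[X]} {n d N : ℕ} (hg : g.natDegree ≤ n) (h : d + n < N)
    (x : ℝ) :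
    ∑ i : Fin N, x ^ (i : ℕ) *
      (if (i : ℕ) ∈ Set.Icc d (d + n) then g.coeff (i - d) else 0) = x ^ d * g.eval x := by
  have hdeg : (X ^ d * g).natDegree < N :=
    (natDegree_mul_le.trans (add_le_add (natDegree_X_pow_le d) hg)).trans_lt h
  have hev : (X ^ d * g).eval x = x ^ d * g.eval x := by simp
  rw [← hev, eval_eq_sum_range' hdeg,
    ← Fin.sum_univ_eq_sum_range (fun i => (X ^ d * g : ℝ[X]).coeff i * x ^ i) N]
  refine Finset.sum_congr rfl fun i _ => ?_
  rw [mul_comm, coeff_X_pow_mul']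
  congr 1
  by_cases h1 : d ≤ (i : ℕ)
  · by_cases h2 : (i : ℕ) ≤ d + n
    · simp [h1, h2]
    · rw [if_neg (by simp [h2]), if_pos h1, coeff_eq_zero_of_natDegree_lt (by lia)]
  · simp [h1]

open Nat in
/-- Two polynomials that are both small at a common point have a small resultant. -/
lemma abs_resultant_le {f g : ℝ[X]} {m n : ℕ} (hf : f.natDegree ≤ m) (hg : g.natDegree ≤ n)
    (hmn : 0 < m + n) {x B δ : ℝ} (hfB : ∀ i, |f.coeff i| ≤ B) (hgB : ∀ i, |g.coeff i| ≤ B)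
    (hfδ : |f.eval x| ≤ δ) (hgδ : |g.eval x| ≤ δ) :
    |resultant f g m n| ≤ (m + n)! * B ^ (m + n - 1) * (max 1 |x| ^ (m + n) * δ) := by
  have hB : 0 ≤ B := (abs_nonneg _).trans (hfB 0)
  have hpow : ∀ d y, d ≤ m + n → |y| ≤ δ → |x ^ d * y| ≤ max 1 |x| ^ (m + n) * δ := by
    intro d y hd hy
    rw [abs_mul, abs_pow]
    refine mul_le_mul ?_ hy (abs_nonneg _) (by positivity)
    calc |x| ^ d ≤ max 1 |x| ^ d := by gcongr; exact le_max_right _ _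
      _ ≤ max 1 |x| ^ (m + n) := pow_le_pow_right₀ (le_max_left _ _) hd
  refine abs_det_le_of_vecMul_le (sylvester f g m n) (fun i => x ^ (i : ℕ)) ⟨0, hmn⟩ (by simp) ?_ ?_
  · intro i j
    induction j using Fin.addCases <;>
    · simp only [sylvester, Matrix.of_apply, Fin.addCases_left, Fin.addCases_right]
      split_ifs
      · first | exact hgB _ | exact hfB _
      · simpa using hB
  · intro j
    simp only [Matrix.vecMul, dotProduct]
    induction j using Fin.addCases with
    | left j =>
      simp only [sylvester, Matrix.of_apply, Fin.addCases_left]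
      rw [sum_pow_mul_sylvester_column hg (by lia)]
      exact hpow _ _ (by lia) hgδ
    | right j =>
      simp only [sylvester, Matrix.of_apply, Fin.addCases_right]
      rw [sum_pow_mul_sylvester_column hf (by lia)]
      exact hpow _ _ (by lia) hfδ

lemma natAbs_coeff_le_polyHeight (Q : ℤ[X]) (i : ℕ) : (Q.coeff i).natAbs ≤ polyHeight Q := by
  by_cases h : Q.coeff i = 0
  · simp [h]
  · exact Finset.le_sup (f := fun i => (Q.coeff i).natAbs) (mem_support_iff.mpr h)

lemma abs_coeff_le_polyHeight (Q : ℤ[X]) (i : ℕ) : |(Q.coeff i : ℝ)| ≤ polyHeight Q := by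
  rw [← Int.cast_abs, Int.abs_eq_natAbs]
  exact_mod_cast natAbs_coeff_le_polyHeight Q i

lemma polyHeight_le_iff {Q : ℤ[X]} {B : ℕ} : polyHeight Q ≤ B ↔ ∀ i, (Q.coeff i).natAbs ≤ B :=
  ⟨fun h i => (natAbs_coeff_le_polyHeight Q i).trans h, fun h => Finset.sup_le fun i _ => h i⟩

lemma polyHeight_neg (Q : ℤ[X]) : polyHeight (-Q) = polyHeight Q := by
  simp [polyHeight]

lemma aeval_eq_eval_map (Q : ℤ[X]) (ξ : ℝ) :
    aeval ξ Q = (Q.map (Int.castRingHom ℝ)).eval ξ := by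
  rw [eval_map, aeval_def]
  rfl

open Nat in
/-- Integer polynomials that are coprime over `ℚ` cannot both be too small at a point. -/
lemma one_le_of_isCoprime {f g : ℤ[X]} {N : ℕ} (hfg : IsCoprime (ratPoly f) (ratPoly g))
    (hpos : 0 < f.natDegree + g.natDegree) (hN : f.natDegree + g.natDegree ≤ N) {ξ B : ℝ}
    (hB : 1 ≤ B) (hfB : ∀ i, |(f.coeff i : ℝ)| ≤ B) (hgB : ∀ i, |(g.coeff i : ℝ)| ≤ B) :
    1 ≤ N ! * B ^ (N - 1) * (max 1 |ξ| ^ N * max |aeval ξ f| |aeval ξ g|) := by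
  have hres : resultant f g ≠ 0 := by
    intro h
    have := resultant_ne_zero _ _ hfg
    rw [ratPoly, ratPoly, natDegree_map_eq_of_injective (Int.castRingHom ℚ).injective_int,
      natDegree_map_eq_of_injective (Int.castRingHom ℚ).injective_int, resultant_map_map, h] at this
    simp at this
  have hle := abs_resultant_le (f := f.map (Int.castRingHom ℝ)) (g := g.map (Int.castRingHom ℝ))
    (m := f.natDegree) (n := g.natDegree) (x := ξ) (B := B)
    (δ := max |aeval ξ f| |aeval ξ g|) natDegree_map_le natDegree_map_le hpos
    (by simpa using hfB) (by simpa using hgB)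
    (by rw [← aeval_eq_eval_map]; exact le_max_left _ _)
    (by rw [← aeval_eq_eval_map]; exact le_max_right _ _)
  have hone : (1 : ℝ) ≤ |resultant (f.map (Int.castRingHom ℝ)) (g.map (Int.castRingHom ℝ))
      f.natDegree g.natDegree| := by
    rw [resultant_map_map, eq_intCast, ← Int.cast_abs]
    exact_mod_cast Int.one_le_abs hres
  refine hone.trans (hle.trans ?_)
  gcongr
  exact le_max_left _ _

/-- The Mahler measure of an integer polynomial. -/
def intMahler (Q : ℤ[X]) : ℝ := (Q.map (Int.castRingHom ℂ)).mahlerMeasure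

lemma intMahler_mul (f g : ℤ[X]) : intMahler (f * g) = intMahler f * intMahler g := by
  rw [intMahler, Polynomial.map_mul, mahlerMeasure_mul]
  rfl

lemma one_le_intMahler {Q : ℤ[X]} (hQ : Q ≠ 0) : 1 ≤ intMahler Q :=
  one_le_mahlerMeasure_of_ne_zero hQ

lemma intMahler_le {Q : ℤ[X]} {n : ℕ} (hQ : Q.natDegree ≤ n) :
    intMahler Q ≤ (n + 1) * polyHeight Q := by
  refine (mahlerMeasure_le_sum_norm_coeff _).trans ?_
  rw [Polynomial.sum_over_range' _ _ (n + 1) (by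
    rw [natDegree_map_eq_of_injective (Int.castRingHom ℂ).injective_int]; lia)]
  · refine (Finset.sum_le_card_nsmul _ _ (polyHeight Q : ℝ) fun i _ => ?_).trans (by simp)
    simpa using abs_coeff_le_polyHeight Q i
  · simp

lemma abs_coeff_le_intMahler {Q : ℤ[X]} {n : ℕ} (hQ : Q.natDegree ≤ n) (i : ℕ) :
    |(Q.coeff i : ℝ)| ≤ 2 ^ n * intMahler Q := by
  have h := norm_coeff_le_choose_mul_mahlerMeasure i (Q.map (Int.castRingHom ℂ))
  rw [natDegree_map_eq_of_injective (Int.castRingHom ℂ).injective_int] at h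
  have h' : |(Q.coeff i : ℝ)| ≤ Q.natDegree.choose i * intMahler Q := by simpa [intMahler] using h
  refine h'.trans (mul_le_mul_of_nonneg_right ?_ (mahlerMeasure_nonneg _))
  calc (Q.natDegree.choose i : ℝ) ≤ 2 ^ Q.natDegree := by exact_mod_cast Nat.choose_le_two_pow _ _
    _ ≤ 2 ^ n := pow_le_pow_right₀ (by norm_num) hQ

namespace IsBestApproxSeq

variable {n : ℕ} {ξ : ℝ} {P : ℕ → ℤ[X]}

lemma abs_aeval_pos (hP : IsBestApproxSeq n ξ P) {k : ℕ} (hk : 1 ≤ k) : 0 < |aeval ξ (P k)| :=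
  (abs_nonneg _).trans_lt (hP.eval_lt k hk)

lemma le_polyHeight (hP : IsBestApproxSeq n ξ P) (k : ℕ) : k ≤ polyHeight (P (k + 1)) := by
  induction k with
  | zero => exact Nat.zero_le _
  | succ k ih => exact ih.trans_lt (hP.height_lt (k + 1) (by lia))

lemma tendsto_polyHeight (hP : IsBestApproxSeq n ξ P) :
    Tendsto (fun k => (polyHeight (P k) : ℝ)) atTop atTop := by
  rw [← tendsto_add_atTop_iff_nat 1]
  exact tendsto_atTop_mono (fun k => by exact_mod_cast hP.le_polyHeight k)
    tendsto_natCast_atTop_atTop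

/-- A best approximation polynomial with an irreducible factor of maximal degree is irreducible. -/
lemma irreducible_of_dvd (hP : IsBestApproxSeq n ξ P) {k : ℕ} (hk : 1 ≤ k) {p : ℤ[X]}
    (hp : Irreducible p) (hpn : n ≤ p.natDegree) (hdvd : p ∣ P k) :
    Irreducible (P k) ∧ (P k).natDegree = n := by
  obtain ⟨q, hq⟩ := hdvd
  have h0 := hP.ne_zero k hk
  have hq0 : q ≠ 0 := by rintro rfl; simp [hq] at h0
  have hdeg := hP.deg_le k hk
  have hmul : (P k).natDegree = p.natDegree + q.natDegree := by
    rw [hq, natDegree_mul hp.ne_zero hq0]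
  obtain ⟨d, rfl⟩ := natDegree_eq_zero.mp (show q.natDegree = 0 by lia)
  have hd0 : d ≠ 0 := by rintro rfl; simp at hq0
  have hheight : polyHeight p ≤ polyHeight (P k) := by
    refine polyHeight_le_iff.mpr fun i => le_trans ?_ (natAbs_coeff_le_polyHeight (P k) i)
    rw [hq, coeff_mul_C, Int.natAbs_mul]
    exact Nat.le_mul_of_pos_right _ (Int.natAbs_pos.mpr hd0)
  have hle := hP.isMin k hk p hp.ne_zero (by lia) hheight
  have hpos := hP.abs_aeval_pos hk
  rw [hq, map_mul, aeval_C, abs_mul] at hle hpos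
  have hppos : 0 < |aeval ξ p| := pos_of_mul_pos_left hpos (abs_nonneg _)
  have hd1 : |(d : ℝ)| ≤ 1 := by
    have : |aeval ξ p| * |(d : ℝ)| ≤ |aeval ξ p| * 1 := by simpa using hle
    exact le_of_mul_le_mul_left this hppos
  have hunit : IsUnit d := by
    rw [Int.isUnit_iff_abs_eq]
    have h1 : |d| ≤ 1 := by exact_mod_cast hd1
    exact le_antisymm h1 (Int.one_le_abs hd0)
  refine ⟨?_, by lia⟩
  rw [hq]
  exact (irreducible_mul_isUnit (isUnit_C.mpr hunit)).mpr hp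

end IsBestApproxSeq

lemma isCoprime_ratPoly {f g : ℤ[X]} (hg : Irreducible g) (hdeg : 0 < g.natDegree)
    (h : ¬ g ∣ f) : IsCoprime (ratPoly f) (ratPoly g) := by
  have hprim := hg.isPrimitive hdeg.ne'
  have hirr : Irreducible (ratPoly g) :=
    (IsPrimitive.Int.irreducible_iff_irreducible_map_cast hprim).mp hg
  exact (hirr.coprime_iff_not_dvd.mpr fun hd =>
    h ((IsPrimitive.Int.dvd_iff_map_cast_dvd_map_cast g f hprim).mpr hd)).symm

lemma tendsto_pow_mul_rpow_neg {n : ℕ} (hn : 1 ≤ n) {w : ℝ} (hwn : 2 * (n : ℝ) - 2 < w) :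
    Tendsto (fun x : ℝ => x ^ (2 * n - 2) * x ^ (-w)) atTop (nhds 0) := by
  have h := tendsto_rpow_neg_atTop (sub_pos.mpr hwn)
  refine h.congr' ?_
  filter_upwards [eventually_gt_atTop 0] with x hx
  rw [← Real.rpow_natCast, ← Real.rpow_add hx]
  congr 1
  rw [Nat.cast_sub (by lia)]
  push_cast
  ring

/-- If `w` is an admissible uniform exponent larger than `2n - 2`, irreducible polynomials of
degree less than `n` satisfy a lower bound with exponent `2n - 2`. -/
lemma exists_le_abs_aeval_of_irreducible {n : ℕ} {ξ : ℝ} {P : ℕ → ℤ[X]} (hn : 1 ≤ n)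
    (hP : IsBestApproxSeq n ξ P) {w : ℝ} (hw : w ∈ uniformExpSet n ξ) (hwn : 2 * (n : ℝ) - 2 < w) :
    ∃ c > 0, c ≤ 1 ∧ ∀ Q : ℤ[X], Irreducible Q → 0 < Q.natDegree → Q.natDegree < n →
      c ≤ |aeval ξ Q| * intMahler Q ^ (2 * n - 2) := by
  set K : ℝ := (2 * n - 1).factorial * (2 ^ n) ^ (2 * n - 2) * max 1 |ξ| ^ (2 * n - 1) with hK
  have hKpos : 0 < K := by positivity
  set a : ℝ := 2 * (n + 1) with ha
  have hapos : 0 < a := by positivity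
  obtain ⟨Y, hY⟩ := eventually_atTop.mp ((hw.and
    (((tendsto_pow_mul_rpow_neg hn hwn).const_mul (K * a ^ (2 * n - 2))).eventually_lt_const
      (u := 1) (by simp))).and (eventually_ge_atTop 1))
  obtain ⟨k, hkY, hk⟩ := ((hP.tendsto_polyHeight.eventually_ge_atTop (2 ^ n * (a * Y))).and
    (eventually_ge_atTop 1)).exists
  refine ⟨min K⁻¹ (min |aeval ξ (P k)| 1), ?_, (min_le_right _ _).trans (min_le_right _ _), ?_⟩
  · exact lt_min (inv_pos.mpr hKpos) (lt_min (hP.abs_aeval_pos hk) one_pos)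
  intro Q hQ hQpos hQn
  have hM := one_le_intMahler hQ.ne_zero
  rcases lt_or_ge (intMahler Q) (a * Y) with hlt | hge
  · refine ((min_le_right _ _).trans (min_le_left _ _)).trans ?_
    have hheight : polyHeight Q ≤ polyHeight (P k) := by
      refine polyHeight_le_iff.mpr fun i => ?_
      have h1 : |(Q.coeff i : ℝ)| ≤ polyHeight (P k) :=
        (abs_coeff_le_intMahler hQn.le i).trans (le_trans (by gcongr) hkY)
      rw [← Int.cast_abs, Int.abs_eq_natAbs] at h1
      exact_mod_cast h1
    exact (hP.isMin k hk Q hQ.ne_zero hQn.le hheight).trans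
      (le_mul_of_one_le_right (abs_nonneg _) (one_le_pow₀ hM))
  · refine (min_le_left _ _).trans ?_
    obtain ⟨x, hx⟩ : ∃ x, intMahler Q = a * x := ⟨intMahler Q / a, by field_simp⟩
    have hYx : Y ≤ x := le_of_mul_le_mul_left (hx ▸ hge) hapos
    obtain ⟨⟨⟨R, hRdeg, hRx, hRpos, hRlt⟩, hsmall⟩, hx1⟩ := hY x hYx
    have hR0 : R ≠ 0 := by rintro rfl; simp at hRpos
    have hn0 : (0 : ℝ) ≤ n := n.cast_nonneg
    have hxM : x ≤ intMahler Q := by rw [hx, ha]; nlinarith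
    have hndvd : ¬ Q ∣ R := by
      rintro ⟨S, rfl⟩
      have h1 : intMahler Q ≤ intMahler (Q * S) := by
        rw [intMahler_mul]
        exact le_mul_of_one_le_right (by linarith) (one_le_intMahler (right_ne_zero_of_mul hR0))
      have h2 := h1.trans (intMahler_le hRdeg)
      have h3 : ((n : ℝ) + 1) * polyHeight (Q * S) ≤ (n + 1) * x := by gcongr
      rw [hx, ha] at h2
      nlinarith
    have hpow : (1 : ℝ) ≤ 2 ^ n := one_le_pow₀ (by norm_num)
    have hmain := one_le_of_isCoprime (N := 2 * n - 1) (ξ := ξ) (B := 2 ^ n * intMahler Q)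
      (isCoprime_ratPoly hQ hQpos hndvd) (by lia) (by lia) (one_le_mul_of_one_le_of_one_le hpow hM)
      (fun i => (abs_coeff_le_polyHeight R i).trans
        (hRx.trans (hxM.trans (le_mul_of_one_le_left (by linarith) hpow))))
      (abs_coeff_le_intMahler hQn.le)
    have hmain' : 1 ≤ K * intMahler Q ^ (2 * n - 2) * max |aeval ξ R| |aeval ξ Q| := by
      refine hmain.trans_eq ?_
      rw [hK, show 2 * n - 1 - 1 = 2 * n - 2 by lia, mul_pow]
      ring
    rcases max_choice |aeval ξ R| |aeval ξ Q| with h | h <;> rw [h] at hmain'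
    · refine absurd hmain' (not_le.mpr (lt_of_le_of_lt ?_ hsmall))
      calc K * intMahler Q ^ (2 * n - 2) * |aeval ξ R|
          ≤ K * intMahler Q ^ (2 * n - 2) * x ^ (-w) := by gcongr
        _ = K * a ^ (2 * n - 2) * (x ^ (2 * n - 2) * x ^ (-w)) := by rw [hx, mul_pow]; ring
    · rw [inv_le_iff_one_le_mul₀' hKpos]
      linarith

lemma one_le_abs_aeval_of_natDegree_eq_zero {Q : ℤ[X]} (hQ : Q ≠ 0) (h : Q.natDegree = 0) (ξ : ℝ) :
    1 ≤ |aeval ξ Q| := by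
  obtain ⟨d, rfl⟩ := natDegree_eq_zero.mp h
  have hd : d ≠ 0 := by rintro rfl; simp at hQ
  rw [aeval_C, algebraMap_int_eq, eq_intCast, ← Int.cast_abs]
  exact_mod_cast Int.one_le_abs hd

/-- A lower bound for irreducible polynomials of degree less than `n` passes to their products. -/
lemma pow_natDegree_le_abs_aeval {n e : ℕ} {ξ c : ℝ} (hc : 0 < c) (hc1 : c ≤ 1)
    (h : ∀ Q : ℤ[X], Irreducible Q → 0 < Q.natDegree → Q.natDegree < n →
      c ≤ |aeval ξ Q| * intMahler Q ^ e) (Q : ℤ[X]) (hQ : Q ≠ 0)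
    (hfac : ∀ p, Irreducible p → p ∣ Q → p.natDegree < n) :
    c ^ Q.natDegree ≤ |aeval ξ Q| * intMahler Q ^ e := by
  have hconst : ∀ q : ℤ[X], q ≠ 0 → q.natDegree = 0 →
      c ^ q.natDegree ≤ |aeval ξ q| * intMahler q ^ e := fun q hq hq0 => by
    rw [hq0, pow_zero]
    exact one_le_mul_of_one_le_of_one_le (one_le_abs_aeval_of_natDegree_eq_zero hq hq0 ξ)
      (one_le_pow₀ (one_le_intMahler hq))
  induction Q using WfDvdMonoid.induction_on_irreducible with
  | zero => exact absurd rfl hQ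
  | unit u hu => exact hconst u hQ (natDegree_eq_zero_of_isUnit hu)
  | mul a i ha hi ih =>
    rw [natDegree_mul hi.ne_zero ha, pow_add, map_mul, abs_mul, intMahler_mul, mul_pow,
      mul_mul_mul_comm]
    have hle : c ^ i.natDegree ≤ |aeval ξ i| * intMahler i ^ e := by
      rcases Nat.eq_zero_or_pos i.natDegree with h0 | hpos
      · exact hconst i hi.ne_zero h0
      · exact (pow_le_of_le_one hc.le hc1 hpos.ne').trans
          (h i hi hpos (hfac i hi (dvd_mul_right _ _)))
    exact mul_le_mul hle (ih ha fun p hp hpa => hfac p hp (hpa.mul_left _)) (by positivity)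
      ((pow_pos hc _).le.trans hle)

/-- If `ŵ_n(ξ) > 2n - 2`, the best approximation polynomials are eventually irreducible of
degree `n`. -/
lemma IsBestApproxSeq.eventually_irreducible {n : ℕ} {ξ : ℝ} {P : ℕ → ℤ[X]} (hn : 1 ≤ n)
    (hP : IsBestApproxSeq n ξ P) (hw : ((2 * (n : ℝ) - 2 : ℝ) : EReal) < wHat n ξ) :
    ∀ᶠ k in atTop, Irreducible (P k) ∧ (P k).natDegree = n := by
  obtain ⟨_, ⟨w, hwmem, rfl⟩, hlt⟩ := lt_sSup_iff.mp hw
  have hwn : 2 * (n : ℝ) - 2 < w := EReal.coe_lt_coe_iff.mp hlt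
  obtain ⟨c, hc, hc1, hbound⟩ := exists_le_abs_aeval_of_irreducible hn hP hwmem hwn
  have hsmall := ((tendsto_pow_mul_rpow_neg hn hwn).const_mul
    (((n : ℝ) + 1) ^ (2 * n - 2))).eventually_lt_const (u := c ^ n) (by simpa using pow_pos hc n)
  filter_upwards [hP.tendsto_polyHeight.eventually hwmem, hP.tendsto_polyHeight.eventually hsmall,
    eventually_ge_atTop 1] with k ⟨R, hRdeg, hRH, hRpos, hRlt⟩ hk hk1
  have hR0 : R ≠ 0 := by rintro rfl; simp at hRpos
  have hPlt : |aeval ξ (P k)| < (polyHeight (P k) : ℝ) ^ (-w) :=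
    (hP.isMin k hk1 R hR0 hRdeg (by exact_mod_cast hRH)).trans_lt hRlt
  have h0 := hP.ne_zero k hk1
  by_contra hcon
  have hfac : ∀ p, Irreducible p → p ∣ P k → p.natDegree < n := fun p hp hd => by
    by_contra hpn
    exact hcon (hP.irreducible_of_dvd hk1 hp (not_lt.mp hpn) hd)
  have hle := pow_natDegree_le_abs_aeval hc hc1 hbound (P k) h0 hfac
  have hM := one_le_intMahler h0
  refine absurd hk (not_lt.mpr ?_)
  calc c ^ n ≤ c ^ (P k).natDegree := pow_le_pow_of_le_one hc.le hc1 (hP.deg_le k hk1)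
    _ ≤ |aeval ξ (P k)| * intMahler (P k) ^ (2 * n - 2) := hle
    _ ≤ (polyHeight (P k) : ℝ) ^ (-w) * ((n + 1) * polyHeight (P k)) ^ (2 * n - 2) := by
        gcongr
        exact intMahler_le (hP.deg_le k hk1)
    _ = _ := by rw [mul_pow]; ring

lemma IsBestApproxSeq.isCoprime_succ {n : ℕ} {ξ : ℝ} {P : ℕ → ℤ[X]} (hn : 1 ≤ n)
    (hP : IsBestApproxSeq n ξ P) {k : ℕ} (hk : 1 ≤ k) (h : Irreducible (P k))
    (h' : Irreducible (P (k + 1))) (hdeg' : (P (k + 1)).natDegree = n) :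
    IsCoprime (ratPoly (P k)) (ratPoly (P (k + 1))) := by
  refine isCoprime_ratPoly h' (by lia) fun hd => ?_
  have hlt := hP.height_lt k hk
  obtain ⟨u, hu⟩ := h'.associated_of_dvd h hd
  obtain ⟨d, hd, hdu⟩ := Polynomial.isUnit_iff.mp u.isUnit
  rw [← hdu] at hu
  rcases Int.isUnit_iff.mp hd with rfl | rfl
  · rw [← hu] at hlt
    simp at hlt
  · rw [← hu] at hlt
    simp [polyHeight_neg] at hlt

/-- For coprime `f` and `g` the polynomials `X ^ i * f` and `X ^ i * g` with `i < m ≤ deg g` are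
linearly independent. -/
lemma linearIndependent_shifts {f g : ℚ[X]} {m : ℕ} (hfg : IsCoprime f g)
    (hg : m ≤ g.natDegree) :
    LinearIndependent ℚ (fun p : Fin 2 × Fin m => X ^ (p.2 : ℕ) * if p.1 = 0 then f else g) := by
  rcases Nat.eq_zero_or_pos m with rfl | hm
  · exact linearIndependent_empty_type
  have hg0 : g ≠ 0 := by rintro rfl; simp at hg; lia
  rw [Fintype.linearIndependent_iff]
  intro a ha
  have hsum : (∑ i : Fin m, C (a (0, i)) * X ^ (i : ℕ)) * f +
      (∑ i : Fin m, C (a (1, i)) * X ^ (i : ℕ)) * g = 0 := by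
    rw [← ha, Fintype.sum_prod_type, Fin.sum_univ_two, Finset.sum_mul, Finset.sum_mul]
    simp [smul_eq_C_mul, mul_assoc]
  have hcoeff : ∀ b : Fin m → ℚ, ∑ i : Fin m, C (b i) * X ^ (i : ℕ) = 0 → ∀ i, b i = 0 := by
    intro b hb i
    have := congrArg (fun q => q.coeff i) hb
    simpa [finsetSum_coeff, coeff_X_pow, Fin.val_inj] using this
  have hA : ∑ i : Fin m, C (a (0, i)) * X ^ (i : ℕ) = 0 := by
    have hdvd : g ∣ ∑ i : Fin m, C (a (0, i)) * X ^ (i : ℕ) :=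
      hfg.symm.dvd_of_dvd_mul_right (by
        rw [eq_neg_of_add_eq_zero_left hsum]
        exact (dvd_mul_left _ _).neg_right)
    refine eq_zero_of_dvd_of_degree_lt hdvd ((degree_sum_fin_lt _).trans_le ?_)
    rw [degree_eq_natDegree hg0]
    exact_mod_cast hg
  rw [hA, zero_mul, zero_add] at hsum
  have hB := (mul_eq_zero.mp hsum).resolve_right hg0
  rintro ⟨j, i⟩
  fin_cases j
  · exact hcoeff _ hA i
  · exact hcoeff _ hB i

lemma Vset_union_eq_range {n : ℕ} (hn : 2 ≤ n) (f g : ℤ[X]) :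
    Vset n f ∪ Vset n g = Set.range (fun p : Fin 2 × Fin (n - 1) =>
      (X : ℚ[X]) ^ (p.2 : ℕ) * ratPoly (if p.1 = 0 then f else g)) := by
  ext q
  constructor
  · rintro (⟨i, hi, rfl⟩ | ⟨i, hi, rfl⟩)
    · exact ⟨(0, ⟨i, by lia⟩), by simp⟩
    · exact ⟨(1, ⟨i, by lia⟩), by simp⟩
  · rintro ⟨⟨j, i⟩, rfl⟩
    fin_cases j
    · exact Or.inl ⟨i, by lia, by simp⟩
    · exact Or.inr ⟨i, by lia, by simp⟩

lemma Vset_subset_degreeLE {n : ℕ} (hn : 2 ≤ n) {f : ℤ[X]} (hf : f.natDegree ≤ n) :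
    Vset n f ⊆ degreeLE ℚ ((2 * n - 2 : ℕ) : WithBot ℕ) := by
  rintro _ ⟨i, hi, rfl⟩
  have hfn : (ratPoly f).natDegree ≤ n := natDegree_map_le.trans hf
  refine mem_degreeLE.mpr (natDegree_le_iff_degree_le.mp ?_)
  exact (natDegree_mul_le.trans (add_le_add (natDegree_X_pow_le i) hfn)).trans (by lia)

/-- if `ŵ_n(ξ) > 2n-2`, then for all sufficiently large `k` the `2(n-1)`
polynomials in `V_{k-1} ∪ V_k` are linearly independent over `ℚ` and span a hyperplane
in the space of polynomials of degree at most `2n-2`. -/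
theorem stmt4 (n : ℕ) (hn : 2 ≤ n) (ξ : ℝ)
    (P : ℕ → Polynomial ℤ) (hP : IsBestApproxSeq n ξ P)
    (hw : ((2*(n:ℝ)-2 : ℝ) : EReal) < wHat n ξ) :
    ∀ᶠ k in Filter.atTop,
      (LinearIndependent ℚ (fun p : Fin 2 × Fin (n-1) =>
        (Polynomial.X : Polynomial ℚ) ^ (p.2 : ℕ) *
          ratPoly (if p.1 = 0 then P (k-1) else P k))) ∧
      Module.finrank ℚ ↥(Submodule.span ℚ (Vset n (P (k-1)) ∪ Vset n (P k))) = 2*n-2 ∧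
      Submodule.span ℚ (Vset n (P (k-1)) ∪ Vset n (P k)) ≤
        Polynomial.degreeLE ℚ ((2*n-2 : ℕ) : WithBot ℕ) := by
  have hev := hP.eventually_irreducible (by lia) hw
  filter_upwards [hev, (tendsto_sub_atTop_nat 1).eventually hev, eventually_ge_atTop 2]
    with k ⟨hirr, hdeg⟩ ⟨hirr', hdeg'⟩ hk
  obtain ⟨k, rfl⟩ : ∃ j, k = j + 1 := ⟨k - 1, by lia⟩
  rw [Nat.add_sub_cancel] at *
  have hratDeg : (ratPoly (P (k + 1))).natDegree = n := by
    rw [ratPoly, natDegree_map_eq_of_injective (Int.castRingHom ℚ).injective_int, hdeg]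
  have hli : LinearIndependent ℚ (fun p : Fin 2 × Fin (n-1) =>
      (Polynomial.X : Polynomial ℚ) ^ (p.2 : ℕ) *
        ratPoly (if p.1 = 0 then P k else P (k + 1))) := by
    simp only [apply_ite ratPoly]
    exact linearIndependent_shifts
      (hP.isCoprime_succ (by lia) (by lia) hirr' hirr hdeg) (by lia)
  refine ⟨hli, ?_, ?_⟩
  · rw [Vset_union_eq_range hn, finrank_span_eq_card hli]
    simp only [Fintype.card_prod, Fintype.card_fin]
    lia
  · exact Submodule.span_le.mpr (Set.union_subset (Vset_subset_degreeLE hn hdeg'.le)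
      (Vset_subset_degreeLE hn hdeg.le))
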